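/- For every R > 1, there exists a smooth function h : ℝ → ℝ such that: (1) h(r) = r for 0 ≤ r ≤ R − δ; (2) h(r) = sinh(r − C) for r > R + δ; (3) h is convex on (0, ∞); where C = R − arcsinh(R) and δ = 1/(4πR·sinh(2R)). -/

import Mathlib

open MeasureTheory in
/-- For every `η > 0` there is a smooth regularization `φ` of `x ↦ max x 0`, equal to it
outside `(-η, η)`, with monotone nonnegative derivative `s`. -/
theorem exists_smooth_positive_part {η : ℝ} (hη : 0 < η) :
    ∃ φ s : ℝ → ℝ, ContDiff ℝ (⊤ : ℕ∞) φ ∧ (∀ x, HasDerivAt φ (s x) x) ∧ Monotone s ∧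
      (∀ x, 0 ≤ s x) ∧ (∀ x ≤ -η, s x = 0) ∧ (∀ x ≤ -η, φ x = 0) ∧ (∀ x, η ≤ x → φ x = x) := by
  set T := Real.smoothTransition
  let s : ℝ → ℝ := fun x => (1 + T (x / η) - T (-x / η)) / 2
  have hs_smooth : ContDiff ℝ (⊤ : ℕ∞) s := by
    have hT : ContDiff ℝ (⊤ : ℕ∞) T := Real.smoothTransition.contDiff
    exact ((contDiff_const.add (hT.comp (contDiff_id.div_const η))).sub
      (hT.comp (contDiff_id.neg.div_const η))).div_const 2
  have hs_cont : Continuous s := hs_smooth.continuous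
  have hs_mono : Monotone s := by
    intro x y hxy
    have h₁ : T (x / η) ≤ T (y / η) := Real.smoothTransition.monotone (by gcongr)
    have h₂ : T (-y / η) ≤ T (-x / η) := Real.smoothTransition.monotone (by gcongr)
    simp only [s]
    linarith
  have hs_nonneg (x : ℝ) : 0 ≤ s x := by
    have h₁ : 0 ≤ T (x / η) := Real.smoothTransition.nonneg _
    have h₂ : T (-x / η) ≤ 1 := Real.smoothTransition.le_one _
    simp only [s]
    linarith
  have hs_zero (x : ℝ) (hx : x ≤ -η) : s x = 0 := by
    have h₁ : T (x / η) = 0 := Real.smoothTransition.zero_of_nonpos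
      (div_nonpos_of_nonpos_of_nonneg (by linarith) hη.le)
    have h₂ : T (-x / η) = 1 := Real.smoothTransition.one_of_one_le
      ((one_le_div hη).2 (by linarith))
    simp [s, h₁, h₂]
  have hs_symm (x : ℝ) : s (-x) = 1 - s x := by
    simp only [s, neg_neg]
    ring
  have hs_one (x : ℝ) (hx : η ≤ x) : s x = 1 := by
    linarith [hs_symm x, hs_zero (-x) (by linarith)]
  have hs_int (a b : ℝ) : IntervalIntegrable s volume a b := hs_cont.intervalIntegrable a b
  have hs_mid : ∫ t in (-η)..η, s t = η := by
    have h₁ : ∫ t in (-η)..η, s (-t) = ∫ t in (-η)..η, s t := by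
      rw [intervalIntegral.integral_comp_neg, neg_neg]
    simp only [hs_symm] at h₁
    rw [intervalIntegral.integral_sub (by simp) (hs_int _ _),
      intervalIntegral.integral_const, smul_eq_mul] at h₁
    linarith
  have hderiv (x : ℝ) : HasDerivAt (fun x => ∫ t in (-η)..x, s t) (s x) x :=
    (hs_cont.integral_hasStrictDerivAt (-η) x).hasDerivAt
  refine ⟨fun x => ∫ t in (-η)..x, s t, s, ?_, hderiv, hs_mono, hs_nonneg, hs_zero, ?_, ?_⟩
  · refine contDiff_infty_iff_deriv.2 ⟨fun x => (hderiv x).differentiableAt, ?_⟩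
    rwa [show deriv (fun x => ∫ t in (-η)..x, s t) = s from funext fun x => (hderiv x).deriv]
  · intro x hx
    apply intervalIntegral.integral_zero_ae
    refine Filter.Eventually.of_forall fun t ht => hs_zero t ?_
    rw [Set.uIoc_of_ge hx] at ht
    exact ht.2
  · intro x hx
    have h₁ : ∫ t in η..x, s t = ∫ _ in η..x, (1 : ℝ) := by
      refine intervalIntegral.integral_congr fun t ht => hs_one t ?_
      rw [Set.uIcc_of_le hx] at ht
      exact ht.1
    change ∫ t in (-η)..x, s t = x
    rw [← intervalIntegral.integral_add_adjacent_intervals (hs_int (-η) η) (hs_int η x), hs_mid,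
      h₁, intervalIntegral.integral_const, smul_eq_mul]
    ring

/-- Existence of the smooth convex radial profile interpolating `r` and `sinh (r - C)`. -/
theorem exists_radial_profile (R : ℝ) (hR : 1 < R) :
    ∃ h : ℝ → ℝ, ContDiff ℝ (⊤ : ℕ∞) h ∧
      (∀ r : ℝ, 0 ≤ r → r ≤ R - 1 / (4 * Real.pi * R * Real.sinh (2 * R)) → h r = r) ∧
      (∀ r : ℝ, r > R + 1 / (4 * Real.pi * R * Real.sinh (2 * R)) →
        h r = Real.sinh (r - (R - Real.arsinh R))) ∧
      ConvexOn ℝ (Set.Ioi 0) h := by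
  have hδ : 0 < 1 / (4 * Real.pi * R * Real.sinh (2 * R)) := by
    have := Real.sinh_pos_iff.2 (show 0 < 2 * R by linarith)
    have := Real.pi_pos
    positivity
  generalize 1 / (4 * Real.pi * R * Real.sinh (2 * R)) = δ at hδ
  have hC : 0 < R - Real.arsinh R := by
    have := Real.self_lt_sinh_iff.2 (Real.arsinh_pos_iff.2 (show 0 < R by linarith))
    rw [Real.sinh_arsinh] at this
    linarith
  have hRC : Real.sinh (R - (R - Real.arsinh R)) = R := by
    rw [sub_sub_cancel, Real.sinh_arsinh]
  generalize R - Real.arsinh R = C at hC hRC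
  let g : ℝ → ℝ := fun r => Real.sinh (r - C) - r
  have hg_mono : StrictMono g := fun x y hxy => by
    have := Real.sinh_sub_id_strictMono (sub_lt_sub_right hxy C)
    simp only [g] at this ⊢
    linarith
  have hg_R : g R = 0 := by simp [g, hRC]
  have hg_C : g C = -C := by simp [g]
  have hg_left : g (R - δ) < 0 := hg_R ▸ hg_mono (by linarith)
  have hg_right : 0 < g (R + δ) := hg_R ▸ hg_mono (by linarith)
  obtain ⟨η, hη, hη_lt⟩ := exists_between (lt_min (lt_min hg_right (neg_pos.2 hg_left)) hC)
  rw [lt_min_iff, lt_min_iff] at hη_lt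
  obtain ⟨⟨hη_right, hη_left⟩, hη_C⟩ := hη_lt
  obtain ⟨φ, s, hφ, hφs, hs_mono, hs_nonneg, hs_zero, hφ_zero, hφ_id⟩ :=
    exists_smooth_positive_part hη
  have hg_deriv (r : ℝ) : HasDerivAt g (Real.cosh (r - C) - 1) r := by
    have := ((hasDerivAt_id r).sub_const C).sinh.sub (hasDerivAt_id r)
    rwa [mul_one] at this
  have hg_smooth : ContDiff ℝ (⊤ : ℕ∞) g :=
    (Real.contDiff_sinh.comp (contDiff_id.sub contDiff_const)).sub contDiff_id
  have hh_deriv (r : ℝ) :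
      HasDerivAt (fun r => r + φ (g r)) (1 + s (g r) * (Real.cosh (r - C) - 1)) r :=
    (hasDerivAt_id r).add ((hφs (g r)).comp r (hg_deriv r))
  refine ⟨fun r => r + φ (g r), contDiff_id.add (hφ.comp hg_smooth), ?_, ?_, ?_⟩
  · intro r _ hr
    have := hg_mono.monotone hr
    simp [hφ_zero (g r) (by linarith)]
  · intro r hr
    have := hg_mono hr
    simp only [hφ_id (g r) (by linarith), g]
    ring
  · refine (Monotone.convexOn_univ_of_deriv (fun r => (hh_deriv r).differentiableAt) ?_).subset
      (Set.subset_univ _) (convex_Ioi 0)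
    intro x y hxy
    rw [(hh_deriv x).deriv, (hh_deriv y).deriv]
    have hcosh (r : ℝ) : 0 ≤ Real.cosh (r - C) - 1 := sub_nonneg.2 (Real.one_le_cosh _)
    gcongr 1 + ?_
    rcases le_total x C with hx | hx
    · have := hg_mono.monotone hx
      rw [hs_zero (g x) (by linarith), zero_mul]
      exact mul_nonneg (hs_nonneg _) (hcosh y)
    · refine mul_le_mul (hs_mono (hg_mono.monotone hxy)) ?_ (hcosh x) (hs_nonneg _)
      gcongr
      rw [Real.cosh_le_cosh, abs_of_nonneg (by linarith), abs_of_nonneg (by linarith)]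
      linarith
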